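/- Let G be a group acting on a set X with n-fold inertia set Iⁿ(X) identified with the set of pairs (g, x) where g is a commuting n-tuple fixing x, with G acting by simultaneous conjugation on g and the given action on x. Let T be a set of representatives for the conjugacy classes of commuting n-tuples in G. Then there is a bijection between the orbit set Iⁿ(X)/G and the disjoint union, over t ∈ T, of the orbit sets (X^{t₁} ∩ … ∩ X^{tₙ}) / C(t₁,…,tₙ), where X^{tᵢ} = {x ∈ X | tᵢ·x = x} and C(t₁,…,tₙ) = ⋂ᵢ centralizer(tᵢ) acts on the intersection of fixed-point sets by restriction of the G-action. -/

import Mathlib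

/-- The set of commuting `n`-tuples in `G`. -/
def CommTuple (G : Type*) [Group G] (n : ℕ) : Type _ :=
  {g : Fin n → G // ∀ i j, g i * g j = g j * g i}

/-- `G` acts on commuting `n`-tuples by simultaneous conjugation. -/
instance CommTuple.instMulAction (G : Type*) [Group G] (n : ℕ) :
    MulAction G (CommTuple G n) where
  smul h g := ⟨fun i => h * g.1 i * h⁻¹, by
    intro i j
    have key : ∀ a b : G, (h * a * h⁻¹) * (h * b * h⁻¹) = h * (a * b) * h⁻¹ := by
      intro a b; group
    rw [key, key, g.2 i j]⟩
  one_smul g := Subtype.ext (by funext i; show 1 * g.1 i * 1⁻¹ = g.1 i; simp)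
  mul_smul a b g := Subtype.ext (by
    funext i
    show (a * b) * g.1 i * (a * b)⁻¹ = a * (b * g.1 i * b⁻¹) * a⁻¹
    group)

/-- The `n`-fold inertia set `Iⁿ(X)`: pairs `(g, x)` where `g` is a commuting `n`-tuple in
`G` each of whose entries fixes `x`. -/
def CommFix (G : Type*) [Group G] (X : Type*) [MulAction G X] (n : ℕ) : Type _ :=
  {q : (Fin n → G) × X //
    (∀ i j, q.1 i * q.1 j = q.1 j * q.1 i) ∧ ∀ i, q.1 i • q.2 = q.2}

/-- `G` acts on `Iⁿ(X)` by simultaneous conjugation on the tuple and the given action on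
the point. -/
instance CommFix.instMulAction (G : Type*) [Group G] (X : Type*) [MulAction G X] (n : ℕ) :
    MulAction G (CommFix G X n) where
  smul h q := ⟨(fun i => h * q.1.1 i * h⁻¹, h • q.1.2), by
    obtain ⟨hc, hfix⟩ := q.2
    refine ⟨fun i j => ?_, fun i => ?_⟩
    · have key : ∀ a b : G, (h * a * h⁻¹) * (h * b * h⁻¹) = h * (a * b) * h⁻¹ := by
        intro a b; group
      rw [key, key, hc i j]
    · show (h * q.1.1 i * h⁻¹) • (h • q.1.2) = h • q.1.2
      rw [mul_smul, mul_smul, inv_smul_smul, hfix i]⟩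
  one_smul q := Subtype.ext (by
    show ((fun i => (1 : G) * q.1.1 i * (1 : G)⁻¹, (1 : G) • q.1.2) : (Fin n → _) × X) = q.1
    simp)
  mul_smul a b q := Subtype.ext (by
    show ((fun i => (a * b) * q.1.1 i * (a * b)⁻¹, (a * b) • q.1.2) : (Fin n → _) × X)
      = (fun i => a * (b * q.1.1 i * b⁻¹) * a⁻¹, a • b • q.1.2)
    rw [mul_smul]
    refine Prod.ext ?_ rfl
    funext i
    group)

/-- The joint centralizer `C(t₁, …, tₙ) = ⋂ᵢ centralizer(tᵢ)` of a commuting tuple. -/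
def jointCentralizer {G : Type*} [Group G] {n : ℕ} (t : CommTuple G n) : Subgroup G :=
  ⨅ i : Fin n, Subgroup.centralizer {t.1 i}

/-- The joint fixed-point set `X^{t₁} ∩ … ∩ X^{tₙ}` of a commuting tuple. -/
def jointFixed {G : Type*} [Group G] (X : Type*) [MulAction G X] {n : ℕ}
    (t : CommTuple G n) : Type _ :=
  {x : X // ∀ i, t.1 i • x = x}

/-- The joint centralizer acts on the joint fixed-point set by restriction of the
`G`-action. -/
instance jointFixed.instMulAction {G : Type*} [Group G] (X : Type*) [MulAction G X]
    {n : ℕ} (t : CommTuple G n) : MulAction (jointCentralizer t) (jointFixed X t) where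
  smul c x := ⟨(c : G) • x.1, by
    intro i
    have hc : t.1 i * (c : G) = (c : G) * t.1 i :=
      Subgroup.mem_centralizer_iff.mp (Subgroup.mem_iInf.mp c.2 i) (t.1 i) rfl
    rw [← mul_smul, hc, mul_smul, x.2 i]⟩
  one_smul x := Subtype.ext (one_smul G x.1)
  mul_smul a b x := Subtype.ext (mul_smul (a : G) (b : G) x.1)

/-- The inclusion of the joint fixed-point set of `t` into the inertia set, `x ↦ (t, x)`. -/
def jointFixed.toCommFix {G : Type*} [Group G] {X : Type*} [MulAction G X] {n : ℕ}
    {t : CommTuple G n} (x : jointFixed X t) : CommFix G X n :=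
  ⟨(t.1, x.1), t.2, x.2⟩

theorem mem_jointCentralizer_of_smul_eq {G : Type*} [Group G] {n : ℕ} {t : CommTuple G n}
    {h : G} (ht : h • t = t) : h ∈ jointCentralizer t := by
  refine Subgroup.mem_iInf.mpr fun i => Subgroup.mem_centralizer_singleton_iff.mpr ?_
  have hi : h * t.1 i * h⁻¹ = t.1 i := congrFun (congrArg Subtype.val ht) i
  exact mul_inv_eq_iff_eq_mul.mp hi

theorem smul_eq_of_mem_jointCentralizer {G : Type*} [Group G] {n : ℕ} {t : CommTuple G n}
    {h : G} (hh : h ∈ jointCentralizer t) : h • t = t := by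
  refine Subtype.ext (funext fun i => mul_inv_eq_iff_eq_mul.mpr ?_)
  exact Subgroup.mem_centralizer_singleton_iff.mp (Subgroup.mem_iInf.mp hh i)

theorem smul_toCommFix_eq_iff {G : Type*} [Group G] {X : Type*} [MulAction G X] {n : ℕ}
    {s t : CommTuple G n} {x : jointFixed X s} {y : jointFixed X t} {h : G} :
    h • x.toCommFix = y.toCommFix ↔ h • s = t ∧ h • x.1 = y.1 := by
  refine ⟨fun e => ?_, fun ⟨e₁, e₂⟩ => ?_⟩
  · have e' := congrArg Subtype.val e
    exact ⟨Subtype.ext (congrArg Prod.fst e'), congrArg Prod.snd e'⟩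
  · exact Subtype.ext (Prod.ext (congrArg Subtype.val e₁) e₂)

/-- The map `X^{t₁} ∩ … ∩ X^{tₙ} / C(t₁, …, tₙ) → Iⁿ(X)/G` induced by the inclusion. -/
def jointFixed.orbitMap {G : Type*} [Group G] (X : Type*) [MulAction G X] {n : ℕ}
    (t : CommTuple G n) :
    Quotient (MulAction.orbitRel (jointCentralizer t) (jointFixed X t)) →
      Quotient (MulAction.orbitRel G (CommFix G X n)) :=
  Quotient.map jointFixed.toCommFix fun _ _ ⟨c, hc⟩ =>
    ⟨c, smul_toCommFix_eq_iff.mpr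
      ⟨smul_eq_of_mem_jointCentralizer c.2, congrArg Subtype.val hc⟩⟩

/-- If `T` is a set of representatives for the conjugacy classes of commuting `n`-tuples
in `G`, then the orbit set `Iⁿ(X)/G` is in bijection with the disjoint union, over
`t ∈ T`, of the orbit sets `(X^{t₁} ∩ … ∩ X^{tₙ}) / C(t₁, …, tₙ)`. -/
theorem orbit_decomposition_of_inertia (G : Type*) [Group G] (X : Type*) [MulAction G X]
    (n : ℕ) (T : Set (CommTuple G n))
    (hT : ∀ g : CommTuple G n, ∃! t, t ∈ T ∧ ∃ h : G, h • t = g) :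
    Nonempty (Quotient (MulAction.orbitRel G (CommFix G X n)) ≃
      Σ t : T, Quotient (MulAction.orbitRel (jointCentralizer (t : CommTuple G n))
        (jointFixed X (t : CommTuple G n)))) := by
  let f : (Σ t : T, Quotient (MulAction.orbitRel (jointCentralizer (t : CommTuple G n))
      (jointFixed X (t : CommTuple G n)))) → Quotient (MulAction.orbitRel G (CommFix G X n)) :=
    fun p => jointFixed.orbitMap X p.1.1 p.2
  refine ⟨(Equiv.ofBijective f ⟨?_, ?_⟩).symm⟩
  · rintro ⟨⟨t, ht⟩, p⟩ ⟨⟨s, hs⟩, q⟩ hpq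
    induction p using Quotient.inductionOn with | _ x
    induction q using Quotient.inductionOn with | _ y
    obtain ⟨h, hh⟩ := Quotient.exact hpq
    obtain ⟨hst, hyx⟩ := smul_toCommFix_eq_iff.mp hh
    obtain rfl : s = t := (hT t).unique ⟨hs, h, hst⟩ ⟨ht, 1, one_smul G t⟩
    exact congrArg (Sigma.mk _) (Quotient.sound
      ⟨⟨h, mem_jointCentralizer_of_smul_eq hst⟩, Subtype.ext hyx⟩)
  · intro q
    induction q using Quotient.inductionOn with | _ q
    obtain ⟨⟨g, x⟩, hg, hx⟩ := q
    obtain ⟨t, ⟨ht, h, hht⟩, -⟩ := hT ⟨g, hg⟩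
    let y : jointFixed X (⟨g, hg⟩ : CommTuple G n) := ⟨x, hx⟩
    have hfix : ∀ i, t.1 i • h⁻¹ • x = h⁻¹ • x := fun i => by
      have hi : h * t.1 i * h⁻¹ = g i := congrFun (congrArg Subtype.val hht) i
      rw [eq_inv_smul_iff, ← mul_smul, ← mul_smul, hi]
      exact hx i
    refine ⟨⟨⟨t, ht⟩, Quotient.mk _ ⟨h⁻¹ • x, hfix⟩⟩, Quotient.sound ⟨h⁻¹, ?_⟩⟩
    exact smul_toCommFix_eq_iff (x := y).mpr ⟨inv_smul_eq_iff.mpr hht.symm, rfl⟩
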